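/- arXiv:2308.13322 — 3 statements merged into one kernel-verified Lean document; each statement's English description precedes it below -/
import Mathlib

section
/- Let (K, v) be a valued field with v : K → Λ ∪ {∞} for a linearly ordered abelian group Λ, and let {ν_i}_{i∈I} be a family of valuations on K[x] with values in Λ ∪ {∞}, all extending v, indexed by a totally ordered set I, such that for all i < j in I one has ν_i(f) ≤ ν_j(f) for every f ∈ K[x] and ν_i ≠ ν_j. Then for every f ∈ K[x], either the family {ν_i(f)}_{i∈I} is strictly increasing (ν_i(f) < ν_j(f) whenever i < j), or there exists i₀ ∈ I such that ν_i(f) = ν_{i₀}(f) for every i ∈ I with i ≥ i₀. -/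
open Polynomial

/-- A valuation on the field `K` with values in `Λ ∪ {∞}`. -/
def IsValdF {K Λ : Type*} [Field K] [AddCommGroup Λ] [LinearOrder Λ] [IsOrderedAddMonoid Λ] (v : K → WithTop Λ) : Prop :=
  (∀ a b : K, v (a * b) = v a + v b) ∧ (∀ a b : K, min (v a) (v b) ≤ v (a + b)) ∧
    (∀ a : K, v a = ⊤ ↔ a = 0)

/-- A valuation on `K[x]` with values in `Λ ∪ {∞}` extending the valuation `v` on `K`. -/
def IsValExt {K Λ : Type*} [Field K] [AddCommGroup Λ] [LinearOrder Λ] [IsOrderedAddMonoid Λ]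
    (v : K → WithTop Λ) (μ : Polynomial K → WithTop Λ) : Prop :=
  (∀ f g : Polynomial K, μ (f * g) = μ f + μ g) ∧
  (∀ f g : Polynomial K, min (μ f) (μ g) ≤ μ (f + g)) ∧
  μ 1 = 0 ∧ μ 0 = ⊤ ∧ (∀ c : K, μ (Polynomial.C c) = v c)

section helpers
variable {K Λ : Type*} [Field K] [AddCommGroup Λ] [LinearOrder Λ] [IsOrderedAddMonoid Λ]
  {v : K → WithTop Λ}

theorem valExt_neg {μ : Polynomial K → WithTop Λ} (h : IsValExt v μ) (f : Polynomial K) :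
    μ (-f) = μ f := by
  have h1 : μ (-1) + μ (-1) = 0 := by
    rw [← h.1]; simpa using h.2.2.1
  have h2 : μ (-1) = 0 := by
    cases hx : μ (-1) with
    | top => rw [hx] at h1; simp at h1
    | coe a =>
      rw [hx] at h1
      have h3 : a + a = 0 := by exact_mod_cast h1
      have h4 : a = 0 := by
        rcases lt_trichotomy a 0 with h5 | h5 | h5
        · exact absurd h3 (add_neg h5 h5).ne
        · exact h5
        · exact absurd h3 (add_pos h5 h5).ne'
      exact_mod_cast h4
  have := h.1 (-1) f
  rw [h2] at this
  simpa using this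

theorem valExt_sub {μ : Polynomial K → WithTop Λ} (h : IsValExt v μ) (f g : Polynomial K) :
    min (μ f) (μ g) ≤ μ (f - g) := by
  rw [sub_eq_add_neg, ← valExt_neg h g]; exact h.2.1 _ _

theorem valExt_mul_lt {μ η : Polynomial K → WithTop Λ} (hμ : IsValExt v μ) (hη : IsValExt v η)
    (hle : ∀ f, μ f ≤ η f) {ψ q : Polynomial K} (hψ : μ ψ < η ψ) {a : WithTop Λ} (ha : a < ⊤)
    (h : a ≤ μ (ψ * q)) : a < η (ψ * q) := by
  rw [hη.1]
  rw [hμ.1] at h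
  by_cases hq : μ q = ⊤
  · have : η q = ⊤ := top_le_iff.mp (hq ▸ hle q)
    simpa [this] using ha
  · refine lt_of_le_of_lt h (lt_of_lt_of_le ?_ (add_le_add_right (hle q) _))
    exact WithTop.add_lt_add_right hq hψ

theorem valExt_iff {μ η : Polynomial K → WithTop Λ} (hμ : IsValExt v μ) (hη : IsValExt v η)
    (hle : ∀ f, μ f ≤ η f) {ψ : Polynomial K} (hψ : μ ψ < η ψ)
    (hmin : ∀ g : Polynomial K, g.degree < ψ.degree → μ g = η g) (f : Polynomial K) :
    μ f < η f ↔ μ f < μ (f % ψ) := by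
  have hψ0 : ψ ≠ 0 := by
    rintro rfl
    rw [hμ.2.2.2.1, hη.2.2.2.1] at hψ
    exact lt_irrefl _ hψ
  have hr : μ (f % ψ) = η (f % ψ) := hmin _ (EuclideanDomain.mod_lt f hψ0)
  have e := EuclideanDomain.div_add_mod f ψ
  have e1 : ψ * (f / ψ) = f - f % ψ := eq_sub_of_add_eq e
  have e2 : f % ψ = f - ψ * (f / ψ) := eq_sub_of_add_eq' e
  have s1 := valExt_sub hμ f (f % ψ)
  rw [← e1] at s1
  constructor
  · intro h
    by_contra hc
    rw [not_lt] at hc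
    rw [min_eq_right hc] at s1
    have t := valExt_mul_lt hμ hη hle hψ (hc.trans_lt (h.trans_le le_top)) s1
    have s2 := valExt_sub hη f (ψ * (f / ψ))
    rw [← e2, ← hr] at s2
    exact absurd (lt_of_lt_of_le (lt_min (hc.trans_lt h) t) s2) (lt_irrefl _)
  · intro h
    rw [min_eq_left h.le] at s1
    have t := valExt_mul_lt hμ hη hle hψ (h.trans_le le_top) s1
    have s2 := hη.2.1 (ψ * (f / ψ)) (f % ψ)
    rw [e, ← hr] at s2
    exact lt_of_lt_of_le (lt_min t h) s2

theorem valExt_exists_min {μ η : Polynomial K → WithTop Λ}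
    (hle : ∀ f, μ f ≤ η f) (hne : μ ≠ η) :
    ∃ ψ : Polynomial K, μ ψ < η ψ ∧ ∀ g : Polynomial K, g.degree < ψ.degree → μ g = η g := by
  have : ∃ f, f ∈ {f : Polynomial K | μ f < η f} := by
    by_contra hc
    push Not at hc
    exact hne (funext fun f => le_antisymm (hle f) (not_lt.mp (hc f)))
  obtain ⟨ψ, h1, h2⟩ := WellFounded.has_min Polynomial.degree_lt_wf _ this
  refine ⟨ψ, h1, fun g hg => ?_⟩
  by_contra hc
  exact h2 g (lt_of_le_of_ne (hle g) hc) hg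

theorem valExt_three {μ η ρ : Polynomial K → WithTop Λ} (hμ : IsValExt v μ) (hη : IsValExt v η)
    (hρ : IsValExt v ρ) (h1 : ∀ f, μ f ≤ η f) (h2 : ∀ f, η f ≤ ρ f) (hne : μ ≠ η)
    (f : Polynomial K) (hf : μ f < ρ f) : μ f < η f := by
  have h3 : ∀ f, μ f ≤ ρ f := fun f => (h1 f).trans (h2 f)
  obtain ⟨φ, hφ, mφ⟩ := valExt_exists_min h1 hne
  have hφ' : μ φ < ρ φ := hφ.trans_le (h2 φ)
  obtain ⟨ψ, hψ, mψ⟩ := valExt_exists_min (μ := μ) (η := ρ) h3 (fun h => by simp [h] at hφ')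
  have key : ¬ ψ.degree < φ.degree := by
    intro hd
    have hr := (valExt_iff hμ hρ h3 hψ mψ φ).1 hφ'
    have hψ0 : 0 < ψ.degree := by
      by_contra hc
      rw [not_lt] at hc
      rw [Polynomial.eq_C_of_degree_le_zero hc, hμ.2.2.2.2, hρ.2.2.2.2] at hψ
      exact lt_irrefl _ hψ
    have hφ0 : φ ≠ 0 := by
      rintro rfl
      simp at hd
    have hq := mφ _ (Polynomial.degree_div_lt hφ0 hψ0)
    have hψe := mφ _ hd
    have e := EuclideanDomain.div_add_mod φ ψ
    have e1 : ψ * (φ / ψ) = φ - φ % ψ := eq_sub_of_add_eq e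
    have s1 := valExt_sub hη φ (φ % ψ)
    rw [← e1, hη.1, ← hq, ← hψe, ← hμ.1] at s1
    have s2 := hμ.2.1 (ψ * (φ / ψ)) (φ % ψ)
    rw [e] at s2
    have s3 := lt_of_lt_of_le (lt_min hφ (hr.trans_le (h1 _))) s1
    exact absurd (lt_of_lt_of_le (lt_min s3 hr) s2) (lt_irrefl _)
  have mφ' : ∀ g : Polynomial K, g.degree < φ.degree → μ g = ρ g := fun g hg =>
    mψ g (hg.trans_le (not_lt.mp key))
  rw [valExt_iff hμ hη h1 hφ mφ]
  exact (valExt_iff hμ hρ h3 hφ' mφ' f).1 hf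

end helpers

/-- for a strictly increasing chain of valuations on `K[x]` extending `v`,
the values of a fixed polynomial are either strictly increasing or ultimately constant. -/
theorem stmt6 {K Λ : Type*} [Field K] [AddCommGroup Λ] [LinearOrder Λ] [IsOrderedAddMonoid Λ]
    (v : K → WithTop Λ) (hv : IsValdF v)
    {I : Type*} [LinearOrder I]
    (ν : I → Polynomial K → WithTop Λ)
    (hval : ∀ i : I, IsValExt v (ν i))
    (hchain : ∀ i j : I, i < j → (∀ f : Polynomial K, ν i f ≤ ν j f) ∧ ν i ≠ ν j) :
    ∀ f : Polynomial K,
      (∀ i j : I, i < j → ν i f < ν j f) ∨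
      (∃ i₀ : I, ∀ i : I, i₀ ≤ i → ν i f = ν i₀ f) := by
  intro f
  by_cases H : ∀ i j : I, i < j → ν i f < ν j f
  · exact Or.inl H
  right
  push Not at H
  obtain ⟨i, j, hij, hf⟩ := H
  refine ⟨i, fun k hk => ?_⟩
  rcases hk.eq_or_lt with rfl | hik
  · rfl
  refine le_antisymm ?_ ((hchain i k hik).1 f)
  rcases lt_trichotomy k j with hkj | rfl | hjk
  · exact ((hchain k j hkj).1 f).trans hf
  · exact hf
  · by_contra hc
    exact absurd (valExt_three (hval i) (hval j) (hval k) (hchain i j hij).1 (hchain j k hjk).1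
      (hchain i j hij).2 f (not_le.mp hc)) (not_lt.mpr hf)
end

section
/- Let (K, v) be a valued field with v : K → Λ ∪ {∞}, Λ a linearly ordered abelian group, and let 𝔳 = {ν_i}_{i∈I} be a family of valuations on K[x] with values in Λ ∪ {∞}, all extending v, indexed by a totally ordered set I, such that for all i < j one has ν_i(f) ≤ ν_j(f) for every f ∈ K[x] and ν_i ≠ ν_j. Let Q and Q' be monic polynomials of the same degree such that Q and Q' are both 𝔳-unstable and every polynomial of degree strictly smaller than deg Q is 𝔳-stable. Then there exists i₀ ∈ I such that ν_i(Q) = ν_i(Q') for every i ∈ I with i ≥ i₀. -/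
open Polynomial

/-- A polynomial `f` is stable for a family `{ν_i}` if the values `ν_i(f)` are
ultimately constant. -/
def FamStable {K Λ I : Type*} [Field K] [AddCommGroup Λ] [LinearOrder Λ] [IsOrderedAddMonoid Λ] [LinearOrder I]
    (ν : I → Polynomial K → WithTop Λ) (f : Polynomial K) : Prop :=
  ∃ i₀ : I, ∀ i : I, i₀ ≤ i → ν i f = ν i₀ f

theorem val_neg_aux {K Λ : Type*} [Field K] [AddCommGroup Λ] [LinearOrder Λ]
    [IsOrderedAddMonoid Λ] {v : K → WithTop Λ} {μ : Polynomial K → WithTop Λ}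
    (h : IsValExt v μ) (f : Polynomial K) : μ (-f) = μ f := by
  obtain ⟨hm, -, h1, -, -⟩ := h
  have h2 : μ (-1) + μ (-1) = 0 := by rw [← hm]; simpa using h1
  have h3 : μ (-1) = 0 := by
    generalize μ (-1) = a at h2
    induction a using WithTop.recTopCoe with
    | top => simp at h2
    | coe a =>
      have h4 : a + a = 0 := by exact_mod_cast h2
      have h5 : a = 0 := by
        rcases lt_trichotomy a 0 with h | h | h
        · exact absurd h4 (add_neg h h).ne
        · exact h
        · exact absurd h4 (add_pos h h).ne'
      rw [h5]; rfl
  have h6 := hm (-1) f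
  rw [h3, zero_add, neg_one_mul] at h6
  exact h6

theorem val_add_aux {K Λ : Type*} [Field K] [AddCommGroup Λ] [LinearOrder Λ]
    [IsOrderedAddMonoid Λ] {v : K → WithTop Λ} {μ : Polynomial K → WithTop Λ}
    (h : IsValExt v μ) (f g : Polynomial K) (hlt : μ f < μ g) : μ (f + g) = μ f := by
  have ha := h.2.1
  apply le_antisymm
  · have h1 := ha (f + g) (-g)
    rw [val_neg_aux h, add_neg_cancel_right] at h1
    rcases min_le_iff.1 h1 with h2 | h2
    · exact h2
    · exact absurd h2 (not_le.2 hlt)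
  · have h1 := ha f g
    rwa [min_eq_left hlt.le] at h1

/-- two monic unstable polynomials of the same, minimal, degree have
ultimately the same values along the family. -/
theorem stmt8 {K Λ : Type*} [Field K] [AddCommGroup Λ] [LinearOrder Λ] [IsOrderedAddMonoid Λ]
    (v : K → WithTop Λ) (hv : IsValdF v)
    {I : Type*} [LinearOrder I]
    (ν : I → Polynomial K → WithTop Λ)
    (hval : ∀ i : I, IsValExt v (ν i))
    (hchain : ∀ i j : I, i < j → (∀ f : Polynomial K, ν i f ≤ ν j f) ∧ ν i ≠ ν j)
    (Q Q' : Polynomial K) (hQ : Q.Monic) (hQ' : Q'.Monic)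
    (hdeg : Q.degree = Q'.degree)
    (hQunst : ¬ FamStable ν Q) (hQ'unst : ¬ FamStable ν Q')
    (hsmall : ∀ h : Polynomial K, h.degree < Q.degree → FamStable ν h) :
    ∃ i₀ : I, ∀ i : I, i₀ ≤ i → ν i Q = ν i Q' := by
  have hlt : (Q' - Q).degree < Q.degree := by
    rw [hdeg]
    exact degree_sub_lt hdeg.symm hQ'.ne_zero (by rw [hQ.leadingCoeff, hQ'.leadingCoeff])
  obtain ⟨i₀, hi₀⟩ := hsmall _ hlt
  have mono : ∀ i j, i ≤ j → ∀ f, ν i f ≤ ν j f := by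
    intro i j hij f
    rcases hij.eq_or_lt with rfl | h
    · exact le_rfl
    · exact (hchain i j h).1 f
  have hle : ∀ i, i₀ ≤ i → ν i Q ≤ ν i₀ (Q' - Q) := by
    intro i hi
    by_contra hc
    have key : ∀ j, i ≤ j → ν j Q' = ν i₀ (Q' - Q) := by
      intro j hj
      have h1 := val_add_aux (hval j) (Q' - Q) Q (by
        rw [hi₀ j (hi.trans hj)]
        exact (not_le.1 hc).trans_le (mono i j hj Q))
      rwa [sub_add_cancel, hi₀ j (hi.trans hj)] at h1
    exact hQ'unst ⟨i, fun j hj => (key j hj).trans (key i le_rfl).symm⟩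
  refine ⟨i₀, fun i hi => ?_⟩
  rcases (hle i hi).eq_or_lt with h | h
  · exact absurd ⟨i, fun j hj => le_antisymm ((hle j (hi.trans hj)).trans h.ge) (mono i j hj Q)⟩ hQunst
  · have h1 := val_add_aux (hval i) Q (Q' - Q) (by rw [hi₀ i hi]; exact h)
    rw [add_sub_cancel] at h1
    exact h1.symm
end

section
/- Let (K, v) be a valued field with v : K → Λ ∪ {∞}, Λ a linearly ordered abelian group, and let 𝔳 = {ν_i}_{i∈I} be an increasing family of valuations on K[x] with values in Λ ∪ {∞}, all extending v, indexed by a totally ordered set I. Let Q be a monic polynomial that is 𝔳-unstable and such that every polynomial of degree strictly smaller than deg Q is 𝔳-stable; for each such smaller-degree polynomial h, let ν_𝔳(h) denote the eventual value of {ν_i(h)}_{i∈I}. Let γ ∈ Λ satisfy ν_i(Q) < γ for every i ∈ I, and let μ be a valuation on K[x] with values in Λ ∪ {∞} extending v such that ν_i(f) ≤ μ(f) for every i ∈ I and every f ∈ K[x], and γ ≤ μ(Q). Then for every f ∈ K[x], writing f = f_0 + f_1 Q + … + f_r Q^r with deg f_j < deg Q for all j (the Q-expansion of f), one has μ(f)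 ≥ min_{0 ≤ j ≤ r} (ν_𝔳(f_j) + j·γ). -/
open Polynomial

/-- The `j`-th coefficient of the `Q`-expansion of a polynomial:
`qExpCoeff Q j f = f_j` where `f = f_0 + f_1 Q + … + f_r Q^r` with `deg f_j < deg Q`. -/
noncomputable def qExpCoeff {K : Type*} [Field K] (Q : Polynomial K) :
    ℕ → Polynomial K → Polynomial K
  | 0, f => f %ₘ Q
  | (n + 1), f => qExpCoeff Q n (f /ₘ Q)

/-- any valuation `μ` dominating an increasing family `{ν_i}`, with
`μ(Q) ≥ γ > ν_i(Q)` for a minimal-degree unstable monic `Q`, dominates the monomial map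
built from the eventual values `ν_𝔳(f_j)` of the `Q`-expansion coefficients. -/
theorem stmt9 {K Λ : Type*} [Field K] [AddCommGroup Λ] [LinearOrder Λ] [IsOrderedAddMonoid Λ]
    (v : K → WithTop Λ) (hv : IsValdF v)
    {I : Type*} [LinearOrder I]
    (ν : I → Polynomial K → WithTop Λ)
    (hval : ∀ i : I, IsValExt v (ν i))
    (hinc : ∀ i j : I, i ≤ j → ∀ f : Polynomial K, ν i f ≤ ν j f)
    (Q : Polynomial K) (hQ : Q.Monic)
    (hQunst : ¬ FamStable ν Q)
    (hsmall : ∀ h : Polynomial K, h.degree < Q.degree → FamStable ν h)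
    (w : Polynomial K → WithTop Λ)
    (hw : ∀ h : Polynomial K, h.degree < Q.degree → ∃ i₀ : I, ∀ i : I, i₀ ≤ i → ν i h = w h)
    (γ : Λ) (hγ : ∀ i : I, ν i Q < (γ : WithTop Λ))
    (μ : Polynomial K → WithTop Λ) (hμval : IsValExt v μ)
    (hμup : ∀ i : I, ∀ f : Polynomial K, ν i f ≤ μ f)
    (hμQ : (γ : WithTop Λ) ≤ μ Q) :
    ∀ f : Polynomial K,
      (Finset.range (f.natDegree + 1)).inf
        (fun j => w (qExpCoeff Q j f) + ((j • γ : Λ) : WithTop Λ)) ≤ μ f := by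
  have hI : ∃ i : I, True := by
    obtain ⟨i, _⟩ := hw 0 (by
      rw [degree_zero, bot_lt_iff_ne_bot, Ne, degree_eq_bot]
      exact hQ.ne_zero)
    exact ⟨i, trivial⟩
  obtain ⟨i₁, -⟩ := hI
  have hQ1 : Q ≠ 1 := by
    rintro rfl
    exact hQunst ⟨i₁, fun i _ => by rw [(hval i).2.2.1, (hval i₁).2.2.1]⟩
  have hQd : 0 < Q.natDegree := by
    rcases Nat.eq_zero_or_pos Q.natDegree with h | h
    · exact absurd (hQ.natDegree_eq_zero.mp h) hQ1
    · exact h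
  have hwμ : ∀ h : Polynomial K, h.degree < Q.degree → w h ≤ μ h := by
    intro h hh
    obtain ⟨i, hi⟩ := hw h hh
    rw [← hi i le_rfl]
    exact hμup i h
  have key : ∀ n : ℕ, ∀ f : Polynomial K, f.natDegree ≤ n →
      ∃ j ∈ Finset.range (n + 1),
        w (qExpCoeff Q j f) + ((j • γ : Λ) : WithTop Λ) ≤ μ f := by
    intro n
    induction n with
    | zero =>
      intro f hf
      refine ⟨0, by simp, ?_⟩
      have hd : f.degree < Q.degree := degree_lt_degree (by omega)
      have : f %ₘ Q = f := (modByMonic_eq_self_iff hQ).2 hd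
      simp only [qExpCoeff, this, zero_smul, WithTop.coe_zero, add_zero]
      exact hwμ f hd
    | succ n ih =>
      intro f hf
      have hdiv : (f /ₘ Q).natDegree ≤ n := by
        rw [natDegree_divByMonic f hQ]
        omega
      have hmin := hμval.2.1 (f %ₘ Q) (Q * (f /ₘ Q))
      rw [modByMonic_add_div f Q] at hmin
      rcases min_le_iff.mp hmin with h | h
      · refine ⟨0, by simp, ?_⟩
        simp only [qExpCoeff, zero_smul, WithTop.coe_zero, add_zero]
        exact (hwμ _ (degree_modByMonic_lt f hQ)).trans h
      · obtain ⟨j, hj, hle⟩ := ih _ hdiv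
        refine ⟨j + 1, by simp at hj ⊢; omega, le_trans ?_ h⟩
        rw [hμval.1, succ_nsmul, WithTop.coe_add, ← add_assoc, add_comm (μ Q)]
        exact add_le_add hle hμQ
  intro f
  obtain ⟨j, hj, hle⟩ := key f.natDegree f le_rfl
  exact (Finset.inf_le hj).trans hle
end
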